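/- For all permutations σ, π of [n], the average of |T2(σ,π) − T2'(σ,π,i1,i2,i3,b)| — taken over all ordered triples (i1,i2,i3) ∈ [n]³ of pairwise distinct elements (each with weight 1/(n(n−1)(n−2))) and over b ∈ {1,2} (each with weight 1/2) — is at most (3/n)·T2(σ,π) + 3n·μ2/((n−1)(n−2)). -/

import Mathlib

/-- The 3-cycle sending `i1 ↦ i2, i2 ↦ i3, i3 ↦ i1` (for pairwise distinct
`i1, i2, i3`), fixing all other elements. -/
def tau1 {n : ℕ} (i1 i2 i3 : Fin n) : Equiv.Perm (Fin n) :=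
  Equiv.swap i1 i3 * Equiv.swap i1 i2

/-- The inverse 3-cycle, sending `i1 ↦ i3, i3 ↦ i2, i2 ↦ i1`. -/
def tau2 {n : ℕ} (i1 i2 i3 : Fin n) : Equiv.Perm (Fin n) :=
  (tau1 i1 i2 i3)⁻¹

/-- The ordered triples of pairwise distinct elements of `Fin n`. -/
def distinctTriples (n : ℕ) : Finset (Fin n × Fin n × Fin n) :=
  Finset.univ.filter
    (fun p : Fin n × Fin n × Fin n => p.1 ≠ p.2.1 ∧ p.1 ≠ p.2.2 ∧ p.2.1 ≠ p.2.2)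

lemma mem_distinctTriples {n : ℕ} (p : Fin n × Fin n × Fin n) :
    p ∈ distinctTriples n ↔ p.1 ≠ p.2.1 ∧ p.1 ≠ p.2.2 ∧ p.2.1 ≠ p.2.2 := by
  simp [distinctTriples]

lemma sum_distinctTriples_rotate {n : ℕ} (f : Fin n → Fin n → Fin n → ℝ) :
    ∑ p ∈ distinctTriples n, f p.2.1 p.2.2 p.1 =
      ∑ p ∈ distinctTriples n, f p.1 p.2.1 p.2.2 := by
  refine Finset.sum_nbij' (fun p => (p.2.1, p.2.2, p.1)) (fun p => (p.2.2, p.1, p.2.1))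
    ?_ ?_ ?_ ?_ ?_ <;> simp only [mem_distinctTriples] <;> grind

lemma sum_distinctTriples_swap {n : ℕ} (f : Fin n → Fin n → Fin n → ℝ) :
    ∑ p ∈ distinctTriples n, f p.1 p.2.2 p.2.1 =
      ∑ p ∈ distinctTriples n, f p.1 p.2.1 p.2.2 := by
  refine Finset.sum_nbij' (fun p => (p.1, p.2.2, p.2.1)) (fun p => (p.1, p.2.2, p.2.1))
    ?_ ?_ ?_ ?_ ?_ <;> simp only [mem_distinctTriples] <;> grind

lemma sum_distinctTriples_fst {n : ℕ} (hn : 2 ≤ n) (g : Fin n → ℝ) :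
    ∑ p ∈ distinctTriples n, g p.1 = ((n : ℝ) - 1) * (n - 2) * ∑ i, g i := by
  have hthird (i j : Fin n) (hij : i ≠ j) :
      ∑ k, (if i ≠ j ∧ i ≠ k ∧ j ≠ k then g i else 0) = ((n : ℝ) - 2) * g i := by
    have hfilter : Finset.univ.filter (fun k => i ≠ j ∧ i ≠ k ∧ j ≠ k) =
        ({i, j} : Finset (Fin n))ᶜ := by
      ext k
      simp only [Finset.mem_filter, Finset.mem_univ, Finset.mem_compl, Finset.mem_insert,
        Finset.mem_singleton]
      grind
    rw [← Finset.sum_filter, hfilter, Finset.sum_const, Finset.card_compl,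
      Finset.card_pair hij, Fintype.card_fin, nsmul_eq_mul, Nat.cast_sub hn]
    norm_num
  have hsecond (i : Fin n) :
      ∑ j, ∑ k, (if i ≠ j ∧ i ≠ k ∧ j ≠ k then g i else 0) =
        ((n : ℝ) - 1) * (n - 2) * g i := by
    rw [← Finset.add_sum_erase _ _ (Finset.mem_univ i),
      Finset.sum_congr rfl (fun j hj => hthird i j (Finset.ne_of_mem_erase hj).symm)]
    rw [Finset.sum_const, Finset.card_erase_of_mem (Finset.mem_univ i), Finset.card_univ,
      Fintype.card_fin, nsmul_eq_mul, Nat.cast_sub (by omega)]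
    simp
    ring
  rw [distinctTriples, Finset.sum_filter, Fintype.sum_prod_type, Finset.mul_sum]
  refine Finset.sum_congr rfl fun i _ => ?_
  rw [Fintype.sum_prod_type]
  exact hsecond i

lemma sum_distinctTriples_le {n : ℕ} (a : Fin n → Fin n → Fin n → ℝ)
    (ha : ∀ i j k, 0 ≤ a i j k) (σ π : Equiv.Perm (Fin n)) :
    ∑ p ∈ distinctTriples n, a p.1 (σ p.2.1) (π p.2.2) ≤ ∑ i, ∑ j, ∑ k, a i j k := by
  calc ∑ p ∈ distinctTriples n, a p.1 (σ p.2.1) (π p.2.2)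
      ≤ ∑ p : Fin n × Fin n × Fin n, a p.1 (σ p.2.1) (π p.2.2) :=
        Finset.sum_le_univ_sum_of_nonneg fun p => ha _ _ _
    _ = ∑ i, ∑ j, ∑ k, a i j k := by
        simp only [Fintype.sum_prod_type]
        refine Finset.sum_congr rfl fun i _ => ?_
        rw [← Equiv.sum_comp σ (fun j => ∑ k, a i j k)]
        exact Finset.sum_congr rfl fun j _ => Equiv.sum_comp π (a i (σ j))

lemma tau2_apply {n : ℕ} (x y z i : Fin n) :
    tau2 x y z i = Equiv.swap x y (Equiv.swap x z i) := by
  simp [tau2, tau1]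

lemma tau1_apply {n : ℕ} (x y z i : Fin n) :
    tau1 x y z i = Equiv.swap x z (Equiv.swap x y i) := rfl

lemma tau1_swap {n : ℕ} (x y z : Fin n) : tau1 x z y = tau2 x y z := by
  ext i
  rw [tau2_apply, tau1_apply]

lemma tau2_swap {n : ℕ} (x y z : Fin n) : tau2 x z y = tau1 x y z := by
  ext i
  rw [tau2_apply, tau1_apply]

/-- Only the three rows moved by the cycle contribute to the difference. -/
lemma abs_sub_sum_tau_le {n : ℕ} (a : Fin n → Fin n → Fin n → ℝ)
    (ha : ∀ i j k, 0 ≤ a i j k) (σ π : Equiv.Perm (Fin n)) {x y z : Fin n}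
    (hxy : x ≠ y) (hxz : x ≠ z) (hyz : y ≠ z) :
    |(∑ i, a i (σ i) (π i)) - ∑ i, a i (σ (tau1 x y z i)) (π (tau2 x y z i))| ≤
      (a x (σ x) (π x) + a y (σ y) (π y) + a z (σ z) (π z)) +
        (a x (σ y) (π z) + a y (σ z) (π x) + a z (σ x) (π y)) := by
  have hsupp : ∑ i ∈ {x, y, z},
        (a i (σ i) (π i) - a i (σ (tau1 x y z i)) (π (tau2 x y z i))) =
      ∑ i, (a i (σ i) (π i) - a i (σ (tau1 x y z i)) (π (tau2 x y z i))) := by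
    refine Finset.sum_subset (Finset.subset_univ _) fun i _ hi => ?_
    simp only [Finset.mem_insert, Finset.mem_singleton, not_or] at hi
    rw [tau1_apply, tau2_apply]
    simp [Equiv.swap_apply_of_ne_of_ne, hi]
  have h1x : tau1 x y z x = y := by
    simp [tau1_apply, Equiv.swap_apply_of_ne_of_ne hxy.symm hyz]
  have h1y : tau1 x y z y = z := by simp [tau1_apply]
  have h1z : tau1 x y z z = x := by
    simp [tau1_apply, Equiv.swap_apply_of_ne_of_ne hxz.symm hyz.symm]
  have h2x : tau2 x y z x = z := by
    simp [tau2_apply, Equiv.swap_apply_of_ne_of_ne hxz.symm hyz.symm]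
  have h2y : tau2 x y z y = x := by
    simp [tau2_apply, Equiv.swap_apply_of_ne_of_ne hxy.symm hyz]
  have h2z : tau2 x y z z = y := by simp [tau2_apply]
  rw [← Finset.sum_sub_distrib, ← hsupp, Finset.sum_insert (by simp [hxy, hxz]),
    Finset.sum_pair hyz, h1x, h1y, h1z, h2x, h2y, h2z, abs_le]
  constructor <;>
  linarith [ha x (σ x) (π x), ha y (σ y) (π y), ha z (σ z) (π z),
    ha x (σ y) (π z), ha y (σ z) (π x), ha z (σ x) (π y)]

lemma sum_abs_sub_sum_tau_le {n : ℕ} (hn : 2 ≤ n) (a : Fin n → Fin n → Fin n → ℝ)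
    (ha : ∀ i j k, 0 ≤ a i j k) (σ π : Equiv.Perm (Fin n)) :
    ∑ p ∈ distinctTriples n, |(∑ i, a i (σ i) (π i)) -
        ∑ i, a i (σ (tau1 p.1 p.2.1 p.2.2 i)) (π (tau2 p.1 p.2.1 p.2.2 i))| ≤
      3 * (((n : ℝ) - 1) * (n - 2) * ∑ i, a i (σ i) (π i)) +
        3 * ∑ i, ∑ j, ∑ k, a i j k := by
  have hdiag := sum_distinctTriples_fst hn (fun i => a i (σ i) (π i))
  have hdiag₂ := sum_distinctTriples_rotate (fun x _ _ => a x (σ x) (π x))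
  have hdiag₃ := sum_distinctTriples_rotate (fun _ x _ => a x (σ x) (π x))
  have hoff := sum_distinctTriples_le a ha σ π
  have hoff₂ := sum_distinctTriples_rotate (fun x y z => a x (σ y) (π z))
  have hoff₃ := sum_distinctTriples_rotate (fun x y z => a y (σ z) (π x))
  refine (Finset.sum_le_sum fun p hp => ?_).trans (?_ : ∑ p ∈ distinctTriples n,
    ((a p.1 (σ p.1) (π p.1) + a p.2.1 (σ p.2.1) (π p.2.1) +
        a p.2.2 (σ p.2.2) (π p.2.2)) +
      (a p.1 (σ p.2.1) (π p.2.2) + a p.2.1 (σ p.2.2) (π p.1) +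
        a p.2.2 (σ p.1) (π p.2.1))) ≤ _)
  · obtain ⟨hxy, hxz, hyz⟩ := (mem_distinctTriples p).1 hp
    exact abs_sub_sum_tau_le a ha σ π hxy hxz hyz
  · simp only [Finset.sum_add_distrib]
    linarith

/-- The average of `|T₂ - T₂'|` over the uniformly chosen pairwise distinct triple
`(i₁,i₂,i₃)` and the fair coin `b ∈ {1,2}` is at most `(3/n)·T₂ + 3n·μ₂/((n-1)(n-2))`,
where `T₂ = ∑ i, a i (σ i) (π i)`, `μ₂ = (∑ i, ∑ j, ∑ k, a i j k)/n²`, and for `b = 1`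
(resp. `b = 2`) `T₂' = ∑ i, a i (σ (τ₁ i)) (π (τ₂ i))` (resp. with `τ₁, τ₂` swapped). -/
theorem T2_first_moment_bound
    (n : ℕ) (hn : 3 ≤ n) (a : Fin n → Fin n → Fin n → ℝ)
    (ha : ∀ i j k, a i j k ∈ Set.Icc (0 : ℝ) 1) (σ π : Equiv.Perm (Fin n)) :
    (∑ p ∈ Finset.univ.filter
        (fun p : Fin n × Fin n × Fin n =>
          p.1 ≠ p.2.1 ∧ p.1 ≠ p.2.2 ∧ p.2.1 ≠ p.2.2),
      (|(∑ i, a i (σ i) (π i)) -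
          ∑ i, a i (σ (tau1 p.1 p.2.1 p.2.2 i)) (π (tau2 p.1 p.2.1 p.2.2 i))| +
        |(∑ i, a i (σ i) (π i)) -
          ∑ i, a i (σ (tau2 p.1 p.2.1 p.2.2 i)) (π (tau1 p.1 p.2.1 p.2.2 i))|) / 2) /
      ((n : ℝ) * (n - 1) * (n - 2)) ≤
    (3 / (n : ℝ)) * (∑ i, a i (σ i) (π i)) +
      3 * (n : ℝ) * ((∑ i, ∑ j, ∑ k, a i j k) / (n ^ 2 : ℝ)) /
        (((n : ℝ) - 1) * ((n : ℝ) - 2)) := by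
  have hbound := sum_abs_sub_sum_tau_le (by omega) a (fun i j k => (ha i j k).1) σ π
  have hswap : ∑ p ∈ distinctTriples n, |(∑ i, a i (σ i) (π i)) -
        ∑ i, a i (σ (tau2 p.1 p.2.1 p.2.2 i)) (π (tau1 p.1 p.2.1 p.2.2 i))| =
      ∑ p ∈ distinctTriples n, |(∑ i, a i (σ i) (π i)) -
        ∑ i, a i (σ (tau1 p.1 p.2.1 p.2.2 i)) (π (tau2 p.1 p.2.1 p.2.2 i))| := by
    rw [← sum_distinctTriples_swap (fun x y z => |(∑ i, a i (σ i) (π i)) -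
      ∑ i, a i (σ (tau1 x y z i)) (π (tau2 x y z i))|)]
    refine Finset.sum_congr rfl fun p _ => ?_
    rw [tau1_swap p.1 p.2.1 p.2.2, tau2_swap p.1 p.2.1 p.2.2]
  have hn' : (3 : ℝ) ≤ n := by exact_mod_cast hn
  have h0 : (0 : ℝ) < n := by linarith
  have h1 : (0 : ℝ) < n - 1 := by linarith
  have h2 : (0 : ℝ) < n - 2 := by linarith
  rw [← distinctTriples, div_le_iff₀ (by positivity), ← Finset.sum_div,
    Finset.sum_add_distrib, hswap]
  refine (?_ : _ ≤ 3 * (((n : ℝ) - 1) * (n - 2) * ∑ i, a i (σ i) (π i)) +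
    3 * ∑ i, ∑ j, ∑ k, a i j k).trans_eq ?_
  · linarith
  · field_simp
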